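/- arXiv:2009.00384 — 5 statements merged into one kernel-verified Lean document; each statement's English description precedes it below -/
import Mathlib

section
/- Let b₁, …, bₙ be vectors in a real inner product space such that ⟪bᵢ, bⱼ⟫ ≤ 0 for all i ≠ j (an obtuse family). Then for any real coefficients v₁, …, vₙ, the norm of the vector with absolute-value coefficients is at most the norm of the original vector: ‖∑ᵢ |vᵢ| • bᵢ‖ ≤ ‖∑ᵢ vᵢ • bᵢ‖. -/
open scoped RealInnerProductSpace BigOperators

/-- If `b₁, …, bₙ` is an obtuse family (all pairwise inner products of distinct
vectors are nonpositive) in a real inner product space, then replacing the real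
coefficients by their absolute values can only decrease the norm of the
linear combination. -/
theorem obtuse_abs_coeff_norm_le
    {E : Type*} [NormedAddCommGroup E] [InnerProductSpace ℝ E] {n : ℕ}
    (b : Fin n → E) (hob : ∀ i j, i ≠ j → ⟪b i, b j⟫ ≤ 0)
    (v : Fin n → ℝ) :
    ‖∑ i, |v i| • b i‖ ≤ ‖∑ i, v i • b i‖ := by
  refine le_of_sq_le_sq ?_ (norm_nonneg _)
  simp only [← real_inner_self_eq_norm_sq, sum_inner, inner_sum, real_inner_smul_left,
    real_inner_smul_right, ← mul_assoc]
  refine Finset.sum_le_sum fun i _ => Finset.sum_le_sum fun j _ => ?_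
  rcases eq_or_ne i j with rfl | hij
  · rw [abs_mul_abs_self]
  · rw [← abs_mul]
    exact mul_le_mul_of_nonpos_right (le_abs_self _) (hob _ _ hij.symm)
end

section
/- Let b₁, …, bₙ be linearly independent vectors in a real inner product space with ⟪bᵢ, bⱼ⟫ ≤ 0 for all i ≠ j, and let L be the ℤ-span of b₁, …, bₙ. If s = ∑ᵢ vᵢ • bᵢ (with vᵢ ∈ ℤ) is a nonzero element of L of minimal norm among all nonzero elements of L, then the vector s' = ∑ᵢ |vᵢ| • bᵢ is also a nonzero element of L of the same minimal norm; in particular, a shortest nonzero lattice vector can always be written with all integer coefficients nonnegative. -/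
open scoped RealInnerProductSpace BigOperators

/-- Replacing the coefficients of a linear combination of pairwise obtuse vectors by their
absolute values does not increase its norm. -/
theorem norm_sum_abs_smul_le_of_obtuse {ι E : Type*} [Fintype ι] [NormedAddCommGroup E]
    [InnerProductSpace ℝ E] (b : ι → E) (hob : ∀ i j, i ≠ j → ⟪b i, b j⟫ ≤ 0) (c : ι → ℝ) :
    ‖∑ i, |c i| • b i‖ ≤ ‖∑ i, c i • b i‖ := by
  refine le_of_sq_le_sq ?_ (norm_nonneg _)
  simp only [← real_inner_self_eq_norm_sq, sum_inner, inner_sum, real_inner_smul_left,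
    real_inner_smul_right]
  refine Finset.sum_le_sum fun i _ => Finset.sum_le_sum fun j _ => ?_
  rw [← mul_assoc, ← mul_assoc]
  by_cases hij : i = j
  · subst hij
    rw [abs_mul_abs_self]
  · rw [← abs_mul]
    exact mul_le_mul_of_nonpos_right (le_abs_self _) (hob j i (Ne.symm hij))

/-- Over an obtuse basis `b₁, …, bₙ` of a lattice (the ℤ-span of the `bᵢ`), if
`s = ∑ vᵢ • bᵢ` is a nonzero lattice vector of minimal norm among nonzero
lattice vectors, then `s' = ∑ |vᵢ| • bᵢ` is also a nonzero lattice vector of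
the same (minimal) norm: a shortest vector can be written with all integer
coefficients nonnegative. -/
theorem obtuse_shortest_vector_abs_coeff
    {E : Type*} [NormedAddCommGroup E] [InnerProductSpace ℝ E] {n : ℕ}
    (b : Fin n → E) (hind : LinearIndependent ℝ b)
    (hob : ∀ i j, i ≠ j → ⟪b i, b j⟫ ≤ 0)
    (v : Fin n → ℤ)
    (hs0 : (∑ i, ((v i : ℝ) • b i)) ≠ 0)
    (hmin : ∀ x ∈ Submodule.span ℤ (Set.range b), x ≠ 0 →
      ‖∑ i, ((v i : ℝ) • b i)‖ ≤ ‖x‖) :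
    (∑ i, ((|v i| : ℝ) • b i)) ∈ Submodule.span ℤ (Set.range b) ∧
    (∑ i, ((|v i| : ℝ) • b i)) ≠ 0 ∧
    ‖∑ i, ((|v i| : ℝ) • b i)‖ = ‖∑ i, ((v i : ℝ) • b i)‖ := by
  have hmem : (∑ i, ((|v i| : ℝ) • b i)) ∈ Submodule.span ℤ (Set.range b) := by
    refine Submodule.sum_mem _ fun i _ => ?_
    rw [← Int.cast_abs, Int.cast_smul_eq_zsmul]
    exact Submodule.smul_mem _ _ (Submodule.subset_span ⟨i, rfl⟩)
  have hne : (∑ i, ((|v i| : ℝ) • b i)) ≠ 0 := by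
    intro h
    have hv := Fintype.linearIndependent_iff.mp hind _ h
    exact hs0 (Finset.sum_eq_zero fun i _ => by rw [abs_eq_zero.mp (hv i), zero_smul])
  exact ⟨hmem, hne, le_antisymm (norm_sum_abs_smul_le_of_obtuse b hob fun i => (v i : ℝ))
    (hmin _ hmem hne)⟩
end

section
/- Let b₁, …, bₙ be vectors in a real inner product space and let S be a subset of the index set such that ⟪bᵢ, bⱼ⟫ ≤ 0 whenever i ≠ j and i, j are both in S or both outside S, and ⟪bᵢ, bⱼ⟫ ≥ 0 whenever i ∈ S and j ∉ S (a semi-obtuse family). Define σᵢ = 1 if i ∈ S and σᵢ = −1 if i ∉ S. Then for any real coefficients v₁, …, vₙ, ‖∑ᵢ σᵢ|vᵢ| • bᵢ‖ ≤ ‖∑ᵢ vᵢ • bᵢ‖. -/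
open scoped RealInnerProductSpace BigOperators

/-- For a semi-obtuse family `b₁, …, bₙ` with respect to a subset `S` of the
indices (pairwise nonpositive inner products within `S` and within its
complement, nonnegative inner products across), replacing each coefficient
`vᵢ` by `σᵢ|vᵢ|` with `σᵢ = 1` on `S` and `σᵢ = -1` off `S` can only decrease
the norm of the linear combination. -/
theorem semiObtuse_signed_abs_coeff_norm_le
    {E : Type*} [NormedAddCommGroup E] [InnerProductSpace ℝ E] {n : ℕ}
    (b : Fin n → E) (S : Finset (Fin n))
    (h₁ : ∀ i j, i ≠ j → i ∈ S → j ∈ S → ⟪b i, b j⟫ ≤ 0)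
    (h₂ : ∀ i j, i ≠ j → i ∉ S → j ∉ S → ⟪b i, b j⟫ ≤ 0)
    (h₃ : ∀ i j, i ∈ S → j ∉ S → 0 ≤ ⟪b i, b j⟫)
    (v : Fin n → ℝ) :
    ‖∑ i, ((if i ∈ S then (1 : ℝ) else -1) * |v i|) • b i‖ ≤
      ‖∑ i, v i • b i‖ := by
  refine (sq_le_sq₀ (norm_nonneg _) (norm_nonneg _)).mp ?_
  rw [← real_inner_self_eq_norm_sq, ← real_inner_self_eq_norm_sq]
  simp only [sum_inner, inner_sum, real_inner_smul_left, real_inner_smul_right]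
  refine Finset.sum_le_sum fun i _ => Finset.sum_le_sum fun j _ => ?_
  rcases eq_or_ne i j with rfl | hij
  · have diag : |v i| * |v i| * ⟪b i, b i⟫ = v i * v i * ⟪b i, b i⟫ := by
      rw [abs_mul_abs_self]
    split_ifs <;> linarith
  · have upper : v i * v j ≤ |v i| * |v j| := abs_mul (v i) (v j) ▸ le_abs_self _
    have lower : -(|v i| * |v j|) ≤ v i * v j := abs_mul (v i) (v j) ▸ neg_abs_le _
    by_cases hi : i ∈ S <;> by_cases hj : j ∈ S <;> simp only [hi, hj, if_true, if_false]
    · linarith [mul_le_mul_of_nonpos_right upper (h₁ j i hij.symm hj hi)]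
    · rw [real_inner_comm]
      linarith [mul_le_mul_of_nonneg_right lower (h₃ i j hi hj)]
    · linarith [mul_le_mul_of_nonneg_right lower (h₃ j i hj hi)]
    · linarith [mul_le_mul_of_nonpos_right upper (h₂ j i hij.symm hj hi)]
end

section
/- Let b₁, …, bₙ be linearly independent vectors in a real inner product space that are semi-obtuse with respect to a subset S of indices, and let L be their ℤ-span. If s = ∑ᵢ vᵢ • bᵢ (with vᵢ ∈ ℤ) is a nonzero element of L of minimal norm among nonzero elements of L, then the vector s' = ∑ᵢ σᵢ|vᵢ| • bᵢ, where σᵢ = 1 for i ∈ S and σᵢ = −1 for i ∉ S, is also a nonzero lattice element of the same minimal norm; in particular, there is a shortest lattice vector whose coefficients are nonnegative on S and nonpositive off S. -/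
open scoped RealInnerProductSpace BigOperators

/-- Comparing two linear combinations of the same vectors term by term in the expansion of the
squared norm. -/
theorem norm_sum_smul_le_of_mul_inner_le {ι E : Type*} [Fintype ι] [NormedAddCommGroup E]
    [InnerProductSpace ℝ E] (b : ι → E) (w v : ι → ℝ)
    (h : ∀ i j, w i * w j * ⟪b i, b j⟫ ≤ v i * v j * ⟪b i, b j⟫) :
    ‖∑ i, w i • b i‖ ≤ ‖∑ i, v i • b i‖ := by
  have expand (u : ι → ℝ) :
      ‖∑ i, u i • b i‖ ^ 2 = ∑ i, ∑ j, u i * u j * ⟪b i, b j⟫ := by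
    simp only [← real_inner_self_eq_norm_sq, sum_inner, inner_sum, real_inner_smul_left,
      real_inner_smul_right, mul_assoc]
    exact Finset.sum_congr rfl fun i _ => Finset.sum_congr rfl fun j _ => by
      rw [real_inner_comm]
  rw [← sq_le_sq₀ (norm_nonneg _) (norm_nonneg _), expand, expand]
  exact Finset.sum_le_sum fun i _ => Finset.sum_le_sum fun j _ => h i j

/-- Integer combinations of a family lie in its ℤ-span. -/
theorem sum_intCast_smul_mem_span_range {ι E : Type*} [Fintype ι] [AddCommGroup E]
    [Module ℝ E] (b : ι → E) (w : ι → ℤ) :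
    ∑ i, (w i : ℝ) • b i ∈ Submodule.span ℤ (Set.range b) := by
  refine Submodule.sum_mem _ fun i _ => ?_
  rw [Int.cast_smul_eq_zsmul]
  exact Submodule.smul_mem _ _ (Submodule.subset_span (Set.mem_range_self i))

/-- Over a semi-obtuse basis `b₁, …, bₙ` (with respect to a subset `S` of
indices) of a lattice (the ℤ-span of the `bᵢ`), if `s = ∑ vᵢ • bᵢ` is a
nonzero lattice vector of minimal norm among nonzero lattice vectors, then
`s' = ∑ σᵢ|vᵢ| • bᵢ`, with `σᵢ = 1` on `S` and `σᵢ = -1` off `S`, is also a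
nonzero lattice vector of the same (minimal) norm: there is a shortest lattice
vector whose coefficients are nonnegative on `S` and nonpositive off `S`. -/
theorem semiObtuse_shortest_vector_signed_abs_coeff
    {E : Type*} [NormedAddCommGroup E] [InnerProductSpace ℝ E] {n : ℕ}
    (b : Fin n → E) (hind : LinearIndependent ℝ b) (S : Finset (Fin n))
    (h₁ : ∀ i j, i ≠ j → i ∈ S → j ∈ S → ⟪b i, b j⟫ ≤ 0)
    (h₂ : ∀ i j, i ≠ j → i ∉ S → j ∉ S → ⟪b i, b j⟫ ≤ 0)
    (h₃ : ∀ i j, i ∈ S → j ∉ S → 0 ≤ ⟪b i, b j⟫)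
    (v : Fin n → ℤ)
    (hs0 : (∑ i, ((v i : ℝ) • b i)) ≠ 0)
    (hmin : ∀ x ∈ Submodule.span ℤ (Set.range b), x ≠ 0 →
      ‖∑ i, ((v i : ℝ) • b i)‖ ≤ ‖x‖) :
    (∑ i, (((if i ∈ S then (1 : ℤ) else -1) * |v i| : ℤ) : ℝ) • b i) ∈
        Submodule.span ℤ (Set.range b) ∧
    (∑ i, (((if i ∈ S then (1 : ℤ) else -1) * |v i| : ℤ) : ℝ) • b i) ≠ 0 ∧
    ‖∑ i, (((if i ∈ S then (1 : ℤ) else -1) * |v i| : ℤ) : ℝ) • b i‖ =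
      ‖∑ i, ((v i : ℝ) • b i)‖ := by
  have hmem := sum_intCast_smul_mem_span_range b
    (fun i => (if i ∈ S then (1 : ℤ) else -1) * |v i|)
  have hne : (∑ i, (((if i ∈ S then (1 : ℤ) else -1) * |v i| : ℤ) : ℝ) • b i) ≠ 0 := by
    intro h0
    have hw := Fintype.linearIndependent_iff.mp hind _ h0
    refine hs0 (Finset.sum_eq_zero fun i _ => ?_)
    have hi := hw i
    have hv : v i = 0 := by
      split_ifs at hi <;> simpa using hi
    simp [hv]
  refine ⟨hmem, hne, le_antisymm ?_ (hmin _ hmem hne)⟩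
  refine norm_sum_smul_le_of_mul_inner_le b _ _ fun i j => ?_
  have hle : (v i : ℝ) * v j ≤ |(v i : ℝ)| * |(v j : ℝ)| := by
    rw [← abs_mul]; exact le_abs_self _
  have hge : -(|(v i : ℝ)| * |(v j : ℝ)|) ≤ (v i : ℝ) * v j := by
    rw [← abs_mul]; exact neg_abs_le _
  rcases eq_or_ne i j with rfl | hij
  · split_ifs <;> simp
  · by_cases hi : i ∈ S <;> by_cases hj : j ∈ S <;>
      simp only [hi, hj, if_true, if_false, Int.cast_neg, Int.cast_abs, one_mul,
        neg_mul, mul_neg, neg_neg]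
    · exact mul_le_mul_of_nonpos_right hle (h₁ i j hij hi hj)
    · simpa only [neg_mul] using mul_le_mul_of_nonneg_right hge (h₃ i j hi hj)
    · simpa only [neg_mul] using
        mul_le_mul_of_nonneg_right hge (real_inner_comm (b i) (b j) ▸ h₃ j i hj hi)
    · exact mul_le_mul_of_nonpos_right hle (h₂ i j hij hi hj)
end

section
/- Let A be an invertible k × k real matrix with rows A₁, …, A_k, let c ∈ ℝᵏ, let N ∈ ℝᵏ with Nᵢ = ‖Aᵢ‖ (Euclidean norm of row i), and for λ ∈ ℝ set p_λ = A⁻¹ · (c + λ • N). If λ ≤ −(√k)/2, then the coordinatewise rounding r of p_λ (rounding each coordinate to a nearest integer) satisfies A · r ≤ c componentwise; in particular, for λ = −(√k)/2 the rounded point is an integer point in the correct region. -/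
open scoped BigOperators

/-- Rounding a point of `ℝᵏ` coordinatewise moves it by Euclidean distance at most `√k / 2`. -/
theorem sqrt_sum_round_sub_sq_le {k : ℕ} (p : Fin k → ℝ) :
    Real.sqrt (∑ j, ((round (p j) : ℝ) - p j) ^ 2) ≤ Real.sqrt k / 2 := by
  have h : ∑ j, ((round (p j) : ℝ) - p j) ^ 2 ≤ ∑ _j : Fin k, (1 / 4 : ℝ) := by
    refine Finset.sum_le_sum fun j _ => ?_
    have hj := abs_le.mp (abs_sub_round (p j))
    nlinarith [hj.1, hj.2]
  refine Real.sqrt_le_iff.mpr ⟨by positivity, h.trans (le_of_eq ?_)⟩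
  rw [div_pow, Real.sq_sqrt (Nat.cast_nonneg k)]
  simp only [Finset.sum_const, Finset.card_univ, Fintype.card_fin, nsmul_eq_mul]
  ring

/-- On the center axis `p_λ = A⁻¹·(c + λ•N)` of the system `A·x ≤ c` (with `A`
an invertible `k × k` real matrix and `N` the vector of Euclidean norms of its
rows), if `λ ≤ -(√k)/2` then the coordinatewise rounding `r` of `p_λ` lies in
the correct region: `A·r ≤ c` componentwise. -/
theorem round_center_axis_in_correct_region
    {k : ℕ} (A : Matrix (Fin k) (Fin k) ℝ) (hA : IsUnit A.det)
    (c N : Fin k → ℝ) (hN : ∀ i, N i = Real.sqrt (∑ j, (A i j) ^ 2))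
    (lam : ℝ) (hlam : lam ≤ -(Real.sqrt k) / 2)
    (r : Fin k → ℝ)
    (hr : ∀ i, r i = round (A⁻¹.mulVec (c + lam • N) i)) :
    ∀ i, A.mulVec r i ≤ c i := by
  intro i
  set p := A⁻¹.mulVec (c + lam • N) with hp
  have hAp : A.mulVec p i = c i + lam * N i := by
    rw [hp, Matrix.mulVec_mulVec, Matrix.mul_nonsing_inv A hA, Matrix.one_mulVec]
    simp
  have hsplit : A.mulVec r i = A.mulVec p i + ∑ j, A i j * ((round (p j) : ℝ) - p j) := by
    simp only [Matrix.mulVec, dotProduct, hr, mul_sub, Finset.sum_sub_distrib]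
    ring
  have hcs := Real.sum_mul_le_sqrt_mul_sqrt Finset.univ (A i)
    (fun j => (round (p j) : ℝ) - p j)
  rw [← hN i] at hcs
  have hNi : 0 ≤ N i := hN i ▸ Real.sqrt_nonneg _
  have hround := mul_le_mul_of_nonneg_left (sqrt_sum_round_sub_sq_le p) hNi
  have hshift := mul_le_mul_of_nonneg_right hlam hNi
  rw [hsplit, hAp]
  linarith
end
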